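/- Let (n, θ) be a closed cycle in which all the values θ i are equal, and let μ : ZMod n → {mountain, valley} be an MV assignment. Then μ is flat foldable as an interior face if and only if the number of creases i with μ i = valley exceeds the number of creases i with μ i = mountain by exactly 2. -/

import Mathlib

/-- Mountain or valley fold type. -/
inductive MV
  | mountain
  | valley
deriving DecidableEq

/-- Designation of a face as interior or exterior. -/
inductive Des
  | interior
  | exterior
deriving DecidableEq

/-- The sign `ε` used at the top layer: `-1` for an interior face, `+1` for an
exterior face. -/
def epsOf : Des → ℝ
  | Des.interior => -1
  | Des.exterior => 1

/-- The folded coordinates of a closed cycle: `x 0 = 0` and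
`x (i+1) = x i + (-1)^i * θ i`. -/
noncomputable def foldedX (n : ℕ) (θ : ZMod n → ℝ) : ZMod n → ℝ :=
  fun i => ∑ j ∈ Finset.range i.val, (-1 : ℝ) ^ j * θ (j : ZMod n)

/-- `(n, θ)` is a closed cycle: `n` is even, `n ≥ 2`, all edge lengths are
positive, and the alternating sum of the edge lengths is zero. -/
noncomputable def IsClosedCycle (n : ℕ) (θ : ZMod n → ℝ) : Prop :=
  Even n ∧ 2 ≤ n ∧ (∀ i, 0 < θ i) ∧
    ∑ j ∈ Finset.range n, (-1 : ℝ) ^ j * θ (j : ZMod n) = 0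

/-- The open interval whose endpoint set is `{a, b}`. -/
def betw (a b : ℝ) : Set ℝ := Set.Ioo (min a b) (max a b)

/-- `L` is a valid layering of the edges of a cycle folded to coordinates `x`:
`L` is injective; (i) no edge passes strictly between the two edges joined at a
crease at the crease's coordinate; (ii) creases at the same coordinate opening in
the same direction are disjoint or nested. -/
def ValidLayering (n : ℕ) (x L : ZMod n → ℝ) : Prop :=
  Function.Injective L ∧
  (∀ i e : ZMod n, x i ∈ betw (x e) (x (e + 1)) →
      L e ∉ betw (L (i - 1)) (L i)) ∧
  (∀ i j : ZMod n, i ≠ j → x i = x j →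
      Real.sign (x (i + 1) - x i) = Real.sign (x (j + 1) - x j) →
      Disjoint (betw (L (i - 1)) (L i)) (betw (L (j - 1)) (L j)) ∨
        betw (L (i - 1)) (L i) ⊆ betw (L (j - 1)) (L j) ∨
        betw (L (j - 1)) (L j) ⊆ betw (L (i - 1)) (L i))

/-- The layering `L` realizes the MV assignment `μ` with top-layer sign `ε`:
taking `t` to be the index maximizing `L` and `s` the alternating `±1` map with
`s t = ε`, each crease `i` is a valley iff `s (i-1)` equals the sign of
`L i - L (i-1)`. -/
def Realizes (n : ℕ) (L : ZMod n → ℝ) (μ : ZMod n → MV) (ε : ℝ) : Prop :=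
  ∃ t : ZMod n, (∀ j, L j ≤ L t) ∧
    ∃ s : ZMod n → ℝ, (∀ i, s i = 1 ∨ s i = -1) ∧ (∀ i, s (i + 1) = -s i) ∧
      s t = ε ∧
      ∀ i, μ i = MV.valley ↔ s (i - 1) = Real.sign (L i - L (i - 1))

/-- The MV assignment `μ` on the closed cycle `(n, θ)` is flat foldable as a
face with designation `d`: some valid layering of the folded cycle realizes it. -/
noncomputable def FlatFoldable (n : ℕ) (θ : ZMod n → ℝ) (μ : ZMod n → MV)
    (d : Des) : Prop :=
  ∃ L : ZMod n → ℝ, ValidLayering n (foldedX n θ) L ∧ Realizes n L μ (epsOf d)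

/-- The folded diameter of a closed cycle: `max x - min x` over the folded
coordinates. -/
noncomputable def foldedDiameter (n : ℕ) [NeZero n] (θ : ZMod n → ℝ) : ℝ :=
  Finset.univ.sup' ⟨0, Finset.mem_univ 0⟩ (foldedX n θ) -
    Finset.univ.inf' ⟨0, Finset.mem_univ 0⟩ (foldedX n θ)


def Btn (a b c : ℝ) : Prop := (a < c ∧ c < b) ∨ (b < c ∧ c < a)

theorem nc_iff {a b c d : ℝ} (hab : a ≠ b) (hcd : c ≠ d) (hac : a ≠ c) (had : a ≠ d)
    (hbc : b ≠ c) (hbd : b ≠ d) :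
    (Disjoint (betw a b) (betw c d) ∨ betw a b ⊆ betw c d ∨ betw c d ⊆ betw a b) ↔
      (Btn a b c ↔ Btn a b d) := by
  rcases lt_or_gt_of_ne hab with h1 | h1 <;> rcases lt_or_gt_of_ne hcd with h2 | h2 <;>
  · simp only [betw, min_eq_left h1.le, min_eq_right h1.le, max_eq_left h1.le, max_eq_right h1.le,
      min_eq_left h2.le, min_eq_right h2.le, max_eq_left h2.le, max_eq_right h2.le]
    rw [Set.Ioo_subset_Ioo_iff h1, Set.Ioo_subset_Ioo_iff h2, Set.Ioo_disjoint_Ioo]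
    simp only [Btn, min_le_iff, le_max_iff]
    grind

theorem btw_symm {a b c d : ℝ} (_ : a ≠ b) (_ : c ≠ d) (hac : a ≠ c) (had : a ≠ d)
    (hbc : b ≠ c) (hbd : b ≠ d) (h : Btn a b c ↔ Btn a b d) :
      (Btn c d a ↔ Btn c d b) := by
  unfold Btn at *
  grind

structure Good (n : ℕ) (L s : ZMod n → ℝ) : Prop where
  inj : Function.Injective L
  pm : ∀ i, s i = 1 ∨ s i = -1
  alt : ∀ i, s (i + 1) = -s i
  nc : ∀ i j, i ≠ j → s i = s j →
    (Btn (L (i - 1)) (L i) (L (j - 1)) ↔ Btn (L (i - 1)) (L i) (L j))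

def emb (m : ℕ) (i : ZMod m) : ZMod (m + 2) := (i.val : ZMod (m + 2))

theorem m2 (m : ℕ) : ((m : ℕ) : ZMod (m + 2)) = -2 := by
  have h : ((m + 2 : ℕ) : ZMod (m + 2)) = 0 := ZMod.natCast_self _
  push_cast at h
  linear_combination h

theorem emb_val (m : ℕ) [NeZero m] (i : ZMod m) : (emb m i).val = i.val := by
  unfold emb
  apply ZMod.val_natCast_of_lt
  have := ZMod.val_lt i
  omega

theorem emb_inj (m : ℕ) [NeZero m] : Function.Injective (emb m) := by
  intro i j h
  have := congrArg ZMod.val h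
  rw [emb_val, emb_val] at this
  exact ZMod.val_injective _ this

theorem val_m2 (m : ℕ) [NeZero m] : (-2 : ZMod (m + 2)).val = m := by
  rw [← m2]; apply ZMod.val_natCast_of_lt; omega

theorem val_m1 (m : ℕ) [NeZero m] : (-1 : ZMod (m + 2)).val = m + 1 := by
  have : (-1 : ZMod (m + 2)) = ((m + 1 : ℕ) : ZMod (m + 2)) := by
    push_cast; rw [m2]; ring
  rw [this]; apply ZMod.val_natCast_of_lt; omega

theorem emb_ne2 (m : ℕ) [NeZero m] (i : ZMod m) : emb m i ≠ -2 := by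
  intro h
  have := congrArg ZMod.val h
  rw [emb_val, val_m2] at this
  have := ZMod.val_lt i
  omega

theorem emb_ne1 (m : ℕ) [NeZero m] (i : ZMod m) : emb m i ≠ -1 := by
  intro h
  have := congrArg ZMod.val h
  rw [emb_val, val_m1] at this
  have := ZMod.val_lt i
  omega

theorem emb_zero (m : ℕ) : emb m 0 = 0 := by
  unfold emb; cases m <;> simp

theorem emb_neg_one (m : ℕ) [NeZero m] : emb m (-1) = -3 := by
  unfold emb
  obtain ⟨k, rfl⟩ : ∃ k, m = k + 1 := ⟨m - 1, by have := NeZero.ne m; omega⟩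
  rw [ZMod.val_neg_one]
  have := m2 (k + 1)
  push_cast at this ⊢
  linear_combination this

theorem emb_sub (m : ℕ) [NeZero m] (i : ZMod m) (hi : i ≠ 0) : emb m (i - 1) = emb m i - 1 := by
  unfold emb
  have h0 : i.val ≠ 0 := by simpa [ZMod.val_eq_zero] using hi
  have hl := ZMod.val_lt i
  have : i - 1 = ((i.val - 1 : ℕ) : ZMod m) := by
    rw [Nat.cast_sub (by omega)]; simp
  rw [this, ZMod.val_natCast_of_lt (by omega), Nat.cast_sub (by omega)]
  simp

theorem emb_cases (m : ℕ) [NeZero m] (j : ZMod (m + 2)) :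
    j = -1 ∨ j = -2 ∨ ∃ i, j = emb m i := by
  have hl := ZMod.val_lt j
  by_cases h1 : j.val = m + 1
  · left; apply ZMod.val_injective; rw [h1, val_m1]
  by_cases h2 : j.val = m
  · right; left; apply ZMod.val_injective; rw [h2, val_m2]
  · right; right
    refine ⟨(j.val : ZMod m), ?_⟩
    apply ZMod.val_injective
    rw [emb_val, ZMod.val_natCast_of_lt (by omega)]

theorem sum_zmod (n : ℕ) [NeZero n] (f : ZMod n → ℝ) :
    ∑ i, f i = ∑ k ∈ Finset.range n, f (k : ZMod n) := by
  symm
  refine Finset.sum_bij (fun (k : ℕ) _ => (k : ZMod n)) ?_ ?_ ?_ ?_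
  · simp
  · intro a ha b hb h
    have := congrArg ZMod.val h
    simp only [Finset.mem_range] at ha hb
    rwa [ZMod.val_natCast_of_lt ha, ZMod.val_natCast_of_lt hb] at this
  · intro b _
    exact ⟨b.val, by simpa using ZMod.val_lt b, by simp⟩
  · simp

theorem sum_emb (m : ℕ) [NeZero m] (f : ZMod (m + 2) → ℝ) :
    ∑ i, f i = f (-1) + f (-2) + ∑ i, f (emb m i) := by
  rw [sum_zmod, sum_zmod, Finset.sum_range_succ, Finset.sum_range_succ]
  have h1 : ((m + 1 : ℕ) : ZMod (m + 2)) = -1 := by push_cast; rw [m2]; ring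
  rw [h1, m2]
  have : ∑ k ∈ Finset.range m, f (emb m (k : ZMod m)) = ∑ k ∈ Finset.range m, f (k : ZMod (m+2)) := by
    apply Finset.sum_congr rfl
    intro k hk
    unfold emb
    rw [ZMod.val_natCast_of_lt (by simpa using hk)]
  rw [this]; ring

theorem two_ne (m : ℕ) [NeZero m] : (2 : ZMod (m + 2)) ≠ 0 := by
  intro h
  have := val_m2 m
  rw [h] at this
  simp at this
  exact NeZero.ne m this.symm

theorem one_ne (m : ℕ) [NeZero m] : (1 : ZMod (m + 2)) ≠ 0 := by
  intro h
  apply two_ne m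
  linear_combination 2 * h

theorem s_prev {n : ℕ} {s : ZMod n → ℝ} (alt : ∀ i, s (i + 1) = -s i) (i : ZMod n) :
    s (i - 1) = - s i := by
  have := alt (i - 1)
  rw [sub_add_cancel] at this
  linarith

theorem alt_emb (m : ℕ) [NeZero m] {s : ZMod (m + 2) → ℝ} (alt : ∀ i, s (i + 1) = -s i)
    (i : ZMod m) : s (emb m (i + 1)) = - s (emb m i) := by
  by_cases h : i + 1 = 0
  · have hi : i = -1 := by linear_combination h
    rw [h, hi, emb_zero, emb_neg_one]
    have h1 := alt (-1)
    have h2 := alt (-2)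
    have h3 := alt (-3)
    rw [show (-1 : ZMod (m+2)) + 1 = 0 by ring] at h1
    rw [show (-2 : ZMod (m+2)) + 1 = -1 by ring] at h2
    rw [show (-3 : ZMod (m+2)) + 1 = -2 by ring] at h3
    linarith
  · have := emb_sub m (i + 1) h
    rw [add_sub_cancel_right] at this
    rw [this, s_prev alt]; ring

theorem four_ne {n : ℕ} {s : ZMod n → ℝ} (pm : ∀ i, s i = 1 ∨ s i = -1)
    (alt : ∀ i, s (i + 1) = -s i) {i j : ZMod n} (hij : i ≠ j) (hs : s i = s j) :
    i ≠ j - 1 ∧ i - 1 ≠ j ∧ i - 1 ≠ j - 1 ∧ i ≠ i - 1 ∧ j ≠ j - 1 := by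
  have h1 := s_prev alt i
  have h2 := s_prev alt j
  have h3 := pm i
  have h4 := pm j
  refine ⟨?_, ?_, ?_, ?_, ?_⟩
  · intro h; rw [h] at hs h3; grind
  · intro h; rw [h] at h1; grind
  · intro h; exact hij (by linear_combination h)
  · intro h; rw [← h] at h1; grind
  · intro h; rw [← h] at h2; grind

theorem sign_id (σ q p p' r : ℝ) (hqp : q ≠ p) (hpp : p ≠ p') (hpr : p' ≠ r) (hqr : q ≠ r)
    (hqp' : q ≠ p') (hpr' : p ≠ r) 
    (h1 : ¬ Btn p p' q) (h2 : ¬ Btn p p' r) (h3 : Btn q p p' ↔ Btn q p r) :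
    σ * Real.sign (p - q) + (-σ) * Real.sign (p' - p) + σ * Real.sign (r - p') =
      σ * Real.sign (r - q) := by
  have key : ∀ x y : ℝ, x ≠ y → (x < y ∧ Real.sign (y - x) = 1) ∨ (y < x ∧ Real.sign (y - x) = -1) := by
    intro x y h
    rcases lt_or_gt_of_ne h with h | h
    · left; exact ⟨h, Real.sign_of_pos (by linarith)⟩
    · right; exact ⟨h, Real.sign_of_neg (by linarith)⟩
  unfold Btn at *
  rcases key q p hqp with ⟨a1, e1⟩ | ⟨a1, e1⟩ <;> rcases key p p' hpp with ⟨a2, e2⟩ | ⟨a2, e2⟩ <;>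
  rcases key p' r hpr with ⟨a3, e3⟩ | ⟨a3, e3⟩ <;> rcases key q r hqr with ⟨a4, e4⟩ | ⟨a4, e4⟩ <;>
  rw [e1, e2, e3, e4] <;> first | ring1 | (exfalso; grind)

theorem good_rot {n : ℕ} {L s : ZMod n → ℝ} (h : Good n L s) (c : ZMod n) :
    Good n (fun i => L (i + c)) (fun i => s (i + c)) where
  inj := fun i j hij => by simpa using h.inj hij
  pm := fun i => h.pm _
  alt := fun i => by
    have := h.alt (i + c)
    rw [show i + 1 + c = i + c + 1 by ring]; exact this
  nc := fun i j hij hs => by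
    have := h.nc (i + c) (j + c) (by simpa using hij) hs
    rw [show i - 1 + c = i + c - 1 by ring, show j - 1 + c = j + c - 1 by ring]; exact this

theorem exists_min_crease {m : ℕ} [NeZero m] {L s : ZMod (m + 2) → ℝ} (h : Good (m + 2) L s)
    (t : ZMod (m + 2)) (ht : ∀ j, L j ≤ L t) :
    ∃ i, i ≠ t ∧ i - 1 ≠ t ∧ ∀ k, ¬ Btn (L (i - 1)) (L i) (L k) := by
  classical
  obtain ⟨i, hi, hmin⟩ := Finset.exists_min_image
    (Finset.univ.filter fun i : ZMod (m + 2) => i ≠ t ∧ i - 1 ≠ t) (fun i => |L i - L (i - 1)|)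
    ⟨t + 2, by
      simp only [Finset.mem_filter, Finset.mem_univ, true_and]
      refine ⟨fun h => two_ne m (by linear_combination h), fun h => one_ne m (by linear_combination h)⟩⟩
  simp only [Finset.mem_filter, Finset.mem_univ, true_and] at hi hmin
  refine ⟨i, hi.1, hi.2, fun k hk => ?_⟩
  obtain ⟨j, hj, hjk⟩ : ∃ j, s i = s j ∧ (j = k ∨ j = k + 1) := by
    have := h.alt k
    have h1 := h.pm i
    have h2 := h.pm k
    by_cases e : s i = s k
    · exact ⟨k, e, Or.inl rfl⟩
    · refine ⟨k + 1, by grind, Or.inr rfl⟩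
  have hki : k ≠ i := by rintro rfl; unfold Btn at hk; grind
  have hki' : k ≠ i - 1 := by rintro rfl; unfold Btn at hk; grind
  have hij : i ≠ j := by
    rintro rfl
    rcases hjk with e | e
    · exact hki e.symm
    · apply hki'; rw [e]; ring
  have nc := h.nc i j hij hj
  have hb : Btn (L (i - 1)) (L i) (L (j - 1)) ∧ Btn (L (i - 1)) (L i) (L j) := by
    rcases hjk with rfl | rfl
    · exact ⟨nc.2 hk, hk⟩
    · rw [add_sub_cancel_right] at nc ⊢
      exact ⟨hk, nc.1 hk⟩
  have t1 := ht i
  have t2 := ht (i - 1)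
  have hlt : |L j - L (j - 1)| < |L i - L (i - 1)| := by
    unfold Btn at hb; grind
  have := hmin j ⟨by rintro rfl; unfold Btn at hb; grind, by intro e; rw [e] at hb; unfold Btn at hb; grind⟩
  linarith

theorem fwd_step {m : ℕ} [NeZero m] 
    (ih : ∀ L s : ZMod m → ℝ, Good m L s → ∀ t, (∀ j, L j ≤ L t) →
      ∑ i, s (i - 1) * Real.sign (L i - L (i - 1)) = -2 * s t)
    (L s : ZMod (m + 2) → ℝ) (h : Good (m + 2) L s) (t : ZMod (m + 2)) (ht : ∀ j, L j ≤ L t)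
    (h1 : t ≠ -1) (h2 : t ≠ -2) (hb : ∀ k, ¬ Btn (L (-2)) (L (-1)) (L k)) :
    ∑ i, s (i - 1) * Real.sign (L i - L (i - 1)) = -2 * s t := by
  have e1 : (-1 : ZMod (m + 2)) - 1 = -2 := by ring
  have e2 : (-2 : ZMod (m + 2)) - 1 = -3 := by ring
  have e0 : (0 : ZMod (m + 2)) - 1 = -1 := by ring
  have s1 := s_prev h.alt (-1)
  have s2 := s_prev h.alt (-2)
  have s0 := s_prev h.alt 0
  rw [e1] at s1; rw [e2] at s2; rw [e0] at s0
  have s20 : s (-2) = s 0 := by linarith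
  have n20 : (-2 : ZMod (m + 2)) ≠ 0 := by simpa using two_ne m
  have c0 := h.nc (-2) 0 n20 s20
  rw [e2, e0] at c0
  have i30 : (-3 : ZMod (m + 2)) ≠ 0 := by
    have := (four_ne h.pm h.alt n20 s20).2.1
    rwa [e2] at this
  have ne : ∀ {i j}, i ≠ j → L i ≠ L j := fun hij e => hij (h.inj e)
  have n10 : (-1 : ZMod (m + 2)) ≠ 0 := by simpa using one_ne m
  have n21 : (-2 : ZMod (m + 2)) ≠ -1 := fun e => n10 (by linear_combination e)
  have n32 : (-3 : ZMod (m + 2)) ≠ -2 := fun e => n10 (by linear_combination e)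
  have n31 : (-3 : ZMod (m + 2)) ≠ -1 := fun e => n20 (by linear_combination e)
  have hid := sign_id (s (-3)) (L (-3)) (L (-2)) (L (-1)) (L 0) (ne n32) (ne n21) (ne n10)
    (ne i30) (ne n31) (ne n20) (hb _) (hb _) c0
  -- the key fact: arcs seen from an arc (c,d)
  have side : ∀ j : ZMod m, j ≠ 0 → s (emb m j) = s 0 →
      (Btn (L (emb m j - 1)) (L (emb m j)) (L (-3)) ↔
        Btn (L (emb m j - 1)) (L (emb m j)) (L 0)) := by
    intro j hj hs
    have j0 : emb m j ≠ 0 := by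
      rw [← emb_zero m]; exact fun e => hj (emb_inj m e)
    have a := h.nc (emb m j) 0 j0 hs
    have b := h.nc (emb m j) (-2) (emb_ne2 m j) (by rw [s20, hs])
    rw [e0] at a; rw [e2] at b
    rw [← a, b]
    have f1 := hb (emb m j)
    have f2 := hb (emb m j - 1)
    have g1 := ne (emb_ne1 m j)
    have g2 := ne (emb_ne2 m j)
    have g3 : L (emb m j - 1) ≠ L (-1) := ne fun e => j0 (by linear_combination e)
    have g4 : L (emb m j - 1) ≠ L (-2) := ne fun e => emb_ne1 m j (by linear_combination e)
    unfold Btn at *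
    grind
  have good : Good m (fun i => L (emb m i)) (fun i => s (emb m i)) := by
    refine ⟨fun i j hij => emb_inj m (h.inj hij), fun i => h.pm _, alt_emb m h.alt, ?_⟩
    intro i j hij hs
    by_cases hi : i = 0
    · subst hi
      rw [zero_sub, emb_neg_one, emb_zero]
      rw [emb_zero] at hs
      rw [emb_sub m j (Ne.symm hij)]
      have := side j (Ne.symm hij) hs.symm
      have j0 : emb m j ≠ 0 := by
        rw [← emb_zero m]; exact fun e => hij (emb_inj m e).symm
      obtain ⟨w1, w2, w3, w4, w5⟩ := four_ne h.pm h.alt j0 hs.symm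
      refine btw_symm (ne w4.symm) (ne i30) ?_ (ne w2) ?_ (ne j0) this
      · exact ne fun e => emb_ne2 m j (by linear_combination e)
      · rw [← emb_neg_one]
        refine ne fun e => ?_
        have e' := emb_inj m e
        have := s_prev (s := fun i => s (emb m i)) (alt_emb m h.alt) (0 : ZMod m)
        simp only [zero_sub] at this
        rw [← e', ← hs, emb_zero] at this
        have := h.pm 0
        grind
    by_cases hj : j = 0
    · subst hj
      rw [zero_sub, emb_neg_one, emb_zero, emb_sub m i hi]
      rw [emb_zero] at hs
      exact side i hi hs
    rw [emb_sub m i hi, emb_sub m j hj]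
    exact h.nc _ _ (fun e => hij (emb_inj m e)) hs
  obtain ⟨t', rfl⟩ : ∃ t', t = emb m t' := by
    rcases emb_cases m t with e | e | e
    · exact absurd e h1
    · exact absurd e h2
    · exact e
  have I := ih _ _ good t' (fun j => ht _)
  rw [sum_emb, ← I, ← Finset.add_sum_erase _ _ (Finset.mem_univ (0 : ZMod m)),
    ← Finset.add_sum_erase _ _ (Finset.mem_univ (0 : ZMod m))]
  have : ∑ x ∈ Finset.univ.erase (0 : ZMod m), s (emb m x - 1) * Real.sign (L (emb m x) - L (emb m x - 1))
    = ∑ x ∈ Finset.univ.erase (0 : ZMod m), s (emb m (x - 1)) * Real.sign (L (emb m x) - L (emb m (x - 1))) := by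
    apply Finset.sum_congr rfl
    intro x hx
    rw [emb_sub m x (by simpa using hx)]
  rw [this, zero_sub, emb_neg_one, emb_zero, e1, e2, e0, ← hid]
  rw [s1.symm.trans s1] at *
  have q1 : s (-2) = - s (-3) := by linarith
  have q2 : s (-1) = s (-3) := by linarith
  rw [q1, q2]; ring

theorem fwd (k : ℕ) : ∀ L s : ZMod (2 * (k + 1)) → ℝ, Good (2 * (k + 1)) L s →
    ∀ t, (∀ j, L j ≤ L t) →
      ∑ i, s (i - 1) * Real.sign (L i - L (i - 1)) = -2 * s t := by
  induction k with
  | zero =>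
    intro L s h t ht
    change ZMod 2 → ℝ at L
    change ZMod 2 → ℝ at s
    change ZMod 2 at t
    have : ∑ i : ZMod 2, s (i - 1) * Real.sign (L i - L (i - 1)) = 
      s 1 * Real.sign (L 0 - L 1) + s 0 * Real.sign (L 1 - L 0) := Fin.sum_univ_two _
    refine this.trans ?_
    have a : s 1 = - s 0 := h.alt 0
    have hne : L 0 ≠ L 1 := fun e => absurd (h.inj e) (by decide)
    have t0 : L 0 ≤ L t := ht 0
    have t1 : L 1 ≤ L t := ht 1
    have tt : t = 0 ∨ t = 1 := by
      clear ht t0 t1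
      revert t; decide
    rcases tt with rfl | rfl
    · have : L 1 < L 0 := lt_of_le_of_ne t1 hne.symm
      rw [Real.sign_of_pos (by linarith), Real.sign_of_neg (by linarith), a]; ring
    · have : L 0 < L 1 := lt_of_le_of_ne t0 hne
      rw [Real.sign_of_neg (by linarith), Real.sign_of_pos (by linarith), a]; ring
  | succ k ih =>
    intro L s h t ht
    have : NeZero (2 * (k + 1)) := ⟨by omega⟩
    change ZMod (2 * (k + 1) + 2) → ℝ at L
    change ZMod (2 * (k + 1) + 2) → ℝ at s
    change ZMod (2 * (k + 1) + 2) at t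
    change Good (2 * (k + 1) + 2) L s at h
    change ∑ i : ZMod (2 * (k + 1) + 2), s (i - 1) * Real.sign (L i - L (i - 1)) = -2 * s t
    obtain ⟨i, hi1, hi2, hb⟩ := exists_min_crease h t ht
    have := fwd_step ih _ _ (good_rot h (i + 1)) (t - (i + 1))
      (fun j => by simpa using ht (j + (i + 1)))
      (fun e => hi1 (by linear_combination -e)) (fun e => hi2 (by linear_combination -e))
      (fun k => by
        have := hb (k + (i + 1))
        rw [show -2 + (i + 1) = i - 1 by ring, show -1 + (i + 1) = i by ring]; exact this)
    simp only [sub_add_cancel] at this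
    rw [← this, ← Equiv.sum_comp (Equiv.addRight (i + 1))]
    apply Finset.sum_congr rfl
    intro j _
    simp only [Equiv.coe_addRight]
    rw [show j + (i + 1) - 1 = j - 1 + (i + 1) by ring]

theorem exists_eps (m : ℕ) [NeZero m] (L : ZMod m → ℝ) (hL : Function.Injective L) (q : ZMod m) :
    ∃ ε : ℝ, 0 < ε ∧ ∀ j, j ≠ q → L j < L q - 3 * ε ∨ L q + 3 * ε < L j := by
  classical
  by_cases hne : (Finset.univ.filter fun j : ZMod m => j ≠ q).Nonempty
  · obtain ⟨i, hi, hmin⟩ := Finset.exists_min_image _ (fun j => |L j - L q|) hne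
    simp only [Finset.mem_filter, Finset.mem_univ, true_and] at hi hmin
    have hpos : 0 < |L i - L q| := abs_pos.2 (sub_ne_zero.2 fun e => hi (hL e))
    refine ⟨|L i - L q| / 4, by linarith, fun j hj => ?_⟩
    have := hmin j hj
    rcases abs_cases (L j - L q) with ⟨e, _⟩ | ⟨e, _⟩
    · right; linarith
    · left; linarith
  · refine ⟨1, one_pos, fun j hj => absurd ⟨j, by simpa using hj⟩ hne⟩

theorem btn_near {σ ε q u v : ℝ} (hσ : σ = 1 ∨ σ = -1) (hε : 0 < ε)
    (a : u < q - 3 * ε ∨ q + 3 * ε < u) (b : v < q - 3 * ε ∨ q + 3 * ε < v) :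
    Btn v u (q + 2 * σ * ε) ↔ Btn v u q := by
  unfold Btn
  rcases hσ with h | h <;> rw [h] <;> grind

set_option maxHeartbeats 1000000 in
theorem bwd_step {m : ℕ} [NeZero m]
    (ih : ∀ μ s : ZMod m → ℝ, (∀ i, μ i = 1 ∨ μ i = -1) → (∀ i, s i = 1 ∨ s i = -1) →
      (∀ i, s (i + 1) = - s i) → ∑ i, μ i = 2 → ∃ L : ZMod m → ℝ, ∃ t, Good m L s ∧
        (∀ j, L j ≤ L t) ∧ s t = -1 ∧ ∀ i, μ i = s (i - 1) * Real.sign (L i - L (i - 1)))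
    (μ s : ZMod (m + 2) → ℝ) (hμ : ∀ i, μ i = 1 ∨ μ i = -1) (pm : ∀ i, s i = 1 ∨ s i = -1)
    (alt : ∀ i, s (i + 1) = - s i) (hsum : ∑ i, μ i = 2) (hm2 : μ (-2) = 1) (hm1 : μ (-1) = -1) :
    ∃ L : ZMod (m + 2) → ℝ, ∃ t, Good (m + 2) L s ∧
        (∀ j, L j ≤ L t) ∧ s t = -1 ∧ ∀ i, μ i = s (i - 1) * Real.sign (L i - L (i - 1)) := by
  classical
  obtain ⟨L', t', good, ht, hst, hturn⟩ := ih (fun i => μ (emb m i)) (fun i => s (emb m i))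
    (fun i => hμ _) (fun i => pm _) (alt_emb m alt) (by rw [sum_emb] at hsum; linarith)
  obtain ⟨ε, hε, hfar⟩ := exists_eps m L' good.inj (-1)
  obtain ⟨σ, hσ⟩ : ∃ σ, σ = s (-3) := ⟨_, rfl⟩
  have hσ1 : σ = 1 ∨ σ = -1 := hσ ▸ pm _
  obtain ⟨L, l1, l2, le⟩ : ∃ L : ZMod (m + 2) → ℝ, L (-1) = L' (-1) + 2 * σ * ε ∧
      L (-2) = L' (-1) + σ * ε ∧ ∀ i, L (emb m i) = L' i := by
    have n21 : (-2 : ZMod (m + 2)) ≠ -1 := fun e => one_ne m (by linear_combination -e)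
    refine ⟨fun j => if j = -1 then L' (-1) + 2 * σ * ε else if j = -2 then L' (-1) + σ * ε else
      L' (j.val : ZMod m), by simp, by simp [n21], fun i => ?_⟩
    simp [emb_ne1, emb_ne2, emb_val]
  have e1 : (-1 : ZMod (m + 2)) - 1 = -2 := by ring
  have e2 : (-2 : ZMod (m + 2)) - 1 = -3 := by ring
  have e0 : (0 : ZMod (m + 2)) - 1 = -1 := by ring
  have s1 := s_prev alt (-1)
  have s2 := s_prev alt (-2)
  have s0 := s_prev alt 0
  rw [e1] at s1; rw [e2] at s2; rw [e0] at s0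
  have l3 : L (-3) = L' (-1) := by rw [← emb_neg_one, le]
  have l0 : L 0 = L' 0 := by rw [← emb_zero m, le]
  have n10 : (0 : ZMod m) ≠ -1 := by
    intro e
    have : s (emb m 0) = s (emb m (-1)) := by rw [← e]
    rw [emb_zero, emb_neg_one] at this
    rcases pm 0 with h | h <;> linarith
  have f0 := hfar 0 n10
  have notb1 : ∀ j, ¬ Btn (L (-2)) (L (-1)) (L' j) := by
    intro j
    rw [l1, l2]; unfold Btn
    by_cases h : j = -1
    · subst h; rcases hσ1 with h | h <;> rw [h] <;> grind
    · have := hfar j h; rcases hσ1 with h | h <;> rw [h] <;> grind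
  have notb2 : ∀ j, ¬ Btn (L (-3)) (L (-2)) (L' j) := by
    intro j
    rw [l3, l2]; unfold Btn
    by_cases h : j = -1
    · subst h; rcases hσ1 with h | h <;> rw [h] <;> grind
    · have := hfar j h; rcases hσ1 with h | h <;> rw [h] <;> grind
  have notb3 : ¬ Btn (L (-3)) (L (-2)) (L (-1)) := by
    rw [l3, l2, l1]; unfold Btn
    rcases hσ1 with h | h <;> rw [h] <;> grind
  have ne12 : L (-1) ≠ L (-2) := by
    rw [l1, l2]; rcases hσ1 with h | h <;> rw [h] <;> grind
  have ne1 : ∀ j, L (-1) ≠ L' j := by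
    intro j
    rw [l1]
    by_cases h : j = -1
    · subst h; rcases hσ1 with h | h <;> rw [h] <;> grind
    · have := hfar j h; rcases hσ1 with h | h <;> rw [h] <;> grind
  have ne2 : ∀ j, L (-2) ≠ L' j := by
    intro j
    rw [l2]
    by_cases h : j = -1
    · subst h; rcases hσ1 with h | h <;> rw [h] <;> grind
    · have := hfar j h; rcases hσ1 with h | h <;> rw [h] <;> grind
  have inj : Function.Injective L := by
    intro i j hij
    rcases emb_cases m i with rfl | rfl | ⟨i, rfl⟩ <;> rcases emb_cases m j with rfl | rfl | ⟨j, rfl⟩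
    · rfl
    · exact absurd hij ne12
    · rw [le] at hij; exact absurd hij (ne1 j)
    · exact absurd hij.symm ne12
    · rfl
    · rw [le] at hij; exact absurd hij (ne2 j)
    · rw [le] at hij; exact absurd hij.symm (ne1 i)
    · rw [le] at hij; exact absurd hij.symm (ne2 i)
    · rw [le, le] at hij; rw [good.inj hij]
  have ne : ∀ {i j}, i ≠ j → L i ≠ L j := fun hij e => hij (inj e)
  have qsymm : ∀ i j, i ≠ j → s i = s j →
      (Btn (L (i - 1)) (L i) (L (j - 1)) ↔ Btn (L (i - 1)) (L i) (L j)) →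
      (Btn (L (j - 1)) (L j) (L (i - 1)) ↔ Btn (L (j - 1)) (L j) (L i)) := by
    intro i j hij hs
    obtain ⟨w1, w2, w3, w4, w5⟩ := four_ne pm alt hij hs
    exact btw_symm (ne w4.symm) (ne w5.symm) (ne w3) (ne w2) (ne w1) (ne hij)
  have q1 : ∀ j, -1 ≠ j → s (-1) = s j →
      (Btn (L (-1 - 1)) (L (-1)) (L (j - 1)) ↔ Btn (L (-1 - 1)) (L (-1)) (L j)) := by
    intro j hj hs
    rcases emb_cases m j with rfl | rfl | ⟨j, rfl⟩
    · exact absurd rfl hj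
    · exfalso; rcases pm (-1) with h | h <;> linarith
    · have j0 : j ≠ 0 := by
        rintro rfl; rw [emb_zero] at hs; rcases pm (-1) with h | h <;> linarith
      rw [e1, ← emb_sub m j j0, le, le]
      simp [notb1]
  have q2 : ∀ j, -2 ≠ j → s (-2) = s j →
      (Btn (L (-2 - 1)) (L (-2)) (L (j - 1)) ↔ Btn (L (-2 - 1)) (L (-2)) (L j)) := by
    intro j hj hs
    rcases emb_cases m j with rfl | rfl | ⟨j, rfl⟩
    · exfalso; rcases pm (-1) with h | h <;> linarith
    · exact absurd rfl hj
    · by_cases j0 : j = 0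
      · subst j0
        rw [emb_zero, e0, e2, l0]
        simp [notb2, notb3]
      rw [e2, ← emb_sub m j j0, le, le]
      simp [notb2]
  have q0 : ∀ j, j ≠ 0 → s (emb m j) = s 0 →
      (Btn (L (emb m j - 1)) (L (emb m j)) (L (0 - 1)) ↔
       Btn (L (emb m j - 1)) (L (emb m j)) (L 0)) := by
    intro j j0 hs
    have := good.nc j 0 j0 (by rw [hs, emb_zero])
    rw [zero_sub] at this
    rw [e0, ← emb_sub m j j0, le, le, l0, ← this, l1]
    have jm : j ≠ -1 := by
      rintro rfl
      rw [emb_neg_one] at hs; rcases pm 0 with h | h <;> linarith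
    have a := hfar j jm
    have b := hfar (j - 1) (fun e => j0 (by linear_combination e))
    exact btn_near hσ1 hε a b
  refine ⟨L, emb m t', ⟨inj, pm, alt, ?_⟩, ?_, hst, ?_⟩
  · intro i j hij hs
    rcases emb_cases m i with rfl | rfl | ⟨i, rfl⟩
    · exact q1 j hij hs
    · exact q2 j hij hs
    rcases emb_cases m j with rfl | rfl | ⟨j, rfl⟩
    · exact qsymm _ _ hij.symm hs.symm (q1 _ hij.symm hs.symm)
    · exact qsymm _ _ hij.symm hs.symm (q2 _ hij.symm hs.symm)
    by_cases i0 : i = 0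
    · subst i0
      have j0 : j ≠ 0 := fun e => hij (by rw [e])
      rw [emb_zero] at *
      exact qsymm _ _ hij.symm hs.symm (q0 j j0 hs.symm)
    by_cases j0 : j = 0
    · subst j0
      rw [emb_zero] at *
      exact q0 i i0 hs
    rw [← emb_sub m i i0, ← emb_sub m j j0, le, le, le, le]
    exact good.nc i j (fun e => hij (by rw [e])) hs
  · have key : L (-1) ≤ L' t' ∧ L (-2) ≤ L' t' := by
      rw [l1, l2]
      by_cases h : t' = -1
      · subst h
        rw [emb_neg_one, ← hσ] at hst
        rw [hst]; constructor <;> linarith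
      · have a := hfar t' h
        have b := ht (-1)
        rcases hσ1 with h | h <;> rw [h] <;> constructor <;> grind
    intro j
    rw [le]
    rcases emb_cases m j with rfl | rfl | ⟨j, rfl⟩
    · exact key.1
    · exact key.2
    · rw [le]; exact ht j
  · intro i
    rcases emb_cases m i with rfl | rfl | ⟨i, rfl⟩
    · rw [e1, hm1, l1, l2, show s (-2) = -σ by linarith]
      rcases hσ1 with h | h <;> rw [h]
      · rw [Real.sign_of_pos (by linarith)]; norm_num
      · rw [Real.sign_of_neg (by linarith)]; norm_num
    · rw [e2, hm2, l2, l3, ← hσ]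
      rcases hσ1 with h | h <;> rw [h]
      · rw [Real.sign_of_pos (by linarith)]; norm_num
      · rw [Real.sign_of_neg (by linarith)]; norm_num
    · have := hturn i
      by_cases i0 : i = 0
      · subst i0
        rw [zero_sub, emb_zero, emb_neg_one, ← hσ] at this
        rw [emb_zero, e0, this, show s (-1) = σ by linarith, l0, l1]
        congr 1
        rcases f0 with f | f
        · rw [Real.sign_of_neg (by linarith), Real.sign_of_neg]
          rcases hσ1 with h | h <;> rw [h] <;> linarith
        · rw [Real.sign_of_pos (by linarith), Real.sign_of_pos]
          rcases hσ1 with h | h <;> rw [h] <;> linarith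
      · rw [← emb_sub m i i0, le, le]; exact this

theorem exists_vm {m : ℕ} [NeZero m] (μ : ZMod (m + 2) → ℝ) (hμ : ∀ i, μ i = 1 ∨ μ i = -1)
    (hsum : ∑ i, μ i = 2) : ∃ i, μ i = 1 ∧ μ (i + 1) = -1 := by
  by_contra hcon
  push Not at hcon
  have hm : (0 : ℝ) < m := by exact_mod_cast Nat.pos_of_ne_zero (NeZero.ne m)
  by_cases h : ∃ i0, μ i0 = 1
  · obtain ⟨i0, h0⟩ := h
    have hk : ∀ k : ℕ, μ (i0 + k) = 1 := by
      intro k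
      induction k with
      | zero => simpa using h0
      | succ k ih =>
        have := hcon _ ih
        push_cast
        rw [← add_assoc]
        exact (hμ _).resolve_right this
    have : ∀ j, μ j = 1 := by
      intro j
      have := hk (j - i0).val
      simpa using this
    simp [this, ZMod.card] at hsum
    exact NeZero.ne m hsum
  · push Not at h
    have : ∀ j, μ j = -1 := fun j => (hμ j).resolve_left (h j)
    simp [this, ZMod.card] at hsum
    linarith

theorem bwd (k : ℕ) : ∀ μ s : ZMod (2 * (k + 1)) → ℝ, (∀ i, μ i = 1 ∨ μ i = -1) →
    (∀ i, s i = 1 ∨ s i = -1) →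
      (∀ i, s (i + 1) = - s i) → ∑ i, μ i = 2 → ∃ L : ZMod (2 * (k + 1)) → ℝ, ∃ t,
        Good (2 * (k + 1)) L s ∧
        (∀ j, L j ≤ L t) ∧ s t = -1 ∧ ∀ i, μ i = s (i - 1) * Real.sign (L i - L (i - 1)) := by
  induction k with
  | zero =>
    intro μ s hμ pm alt hsum
    change ZMod 2 → ℝ at μ
    change ZMod 2 → ℝ at s
    have h2 : μ 0 + μ 1 = 2 := (Fin.sum_univ_two μ).symm.trans hsum
    have p0 : μ 0 = 1 ∨ μ 0 = -1 := hμ 0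
    have p1 : μ 1 = 1 ∨ μ 1 = -1 := hμ 1
    have z2 : ∀ i : ZMod 2, i = 0 ∨ i = 1 := by decide
    have m0 : μ 0 = 1 := by grind
    have m1 : μ 1 = 1 := by grind
    have a : s 1 = - s 0 := alt 0
    have ps : s 0 = 1 ∨ s 0 = -1 := pm 0
    have inj : Function.Injective s := by
      intro i j hij
      rcases z2 i with rfl | rfl <;> rcases z2 j with rfl | rfl <;> first | rfl | (exfalso; grind)
    obtain ⟨t, ht⟩ : ∃ t, s t = -1 := by
      rcases ps with h | h
      · exact ⟨1, by rw [a, h]⟩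
      · exact ⟨0, h⟩
    refine ⟨fun i => - s i, t, ⟨fun i j h => inj (neg_injective h), pm, alt, fun i j hij hs => absurd (inj hs) hij⟩,
      fun j => ?_, ht, fun i => ?_⟩
    · change - s j ≤ - s t
      rw [ht]
      rcases pm j with h | h <;> change s j = _ at h <;> rw [h] <;> norm_num
    · have hm : μ i = 1 := by rcases z2 i with rfl | rfl <;> assumption
      have hp : s (i - 1) = - s i := s_prev (n := 2) alt i
      change μ i = s (i - 1) * Real.sign (- s i - - s (i - 1))
      rw [hm, hp]
      rcases pm i with h | h <;> change s i = _ at h <;> rw [h]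
      · rw [Real.sign_of_neg (by norm_num)]; norm_num
      · rw [Real.sign_of_pos (by norm_num)]; norm_num
  | succ k ih =>
    intro μ s hμ pm alt hsum
    have : NeZero (2 * (k + 1)) := ⟨by omega⟩
    change ZMod (2 * (k + 1) + 2) → ℝ at μ
    change ZMod (2 * (k + 1) + 2) → ℝ at s
    change ∑ i : ZMod (2 * (k + 1) + 2), μ i = 2 at hsum
    change ∀ i : ZMod (2 * (k + 1) + 2), μ i = 1 ∨ μ i = -1 at hμ
    change ∀ i : ZMod (2 * (k + 1) + 2), s i = 1 ∨ s i = -1 at pm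
    change ∀ i : ZMod (2 * (k + 1) + 2), s (i + 1) = - s i at alt
    obtain ⟨i, hi1, hi2⟩ := exists_vm μ hμ hsum
    obtain ⟨L, t, good, ht, hst, hturn⟩ := bwd_step ih (fun j => μ (j + (i + 2))) (fun j => s (j + (i + 2)))
      (fun j => hμ _) (fun j => pm _)
      (fun j => by
        have := alt (j + (i + 2))
        rw [show j + 1 + (i + 2) = j + (i + 2) + 1 by ring]; exact this)
      (by rw [← hsum]; exact Equiv.sum_comp (Equiv.addRight (i + 2)) μ)
      (by rw [← hi1]; congr 1; ring) (by rw [← hi2]; congr 1; ring)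
    have good' := good_rot good (-(i + 2))
    simp only [neg_add_cancel_right] at good'
    refine ⟨fun j => L (j + -(i + 2)), t + (i + 2), good', ?_, hst, ?_⟩
    · intro j
      have := ht (j + -(i + 2))
      change L (j + -(i + 2)) ≤ L (t + (i + 2) + -(i + 2))
      rwa [add_neg_cancel_right]
    · intro j
      have := hturn (j + -(i + 2))
      rw [neg_add_cancel_right, show j + -(i + 2) - 1 + (i + 2) = j - 1 by ring] at this
      change μ j = s (j - 1) * Real.sign (L (j + -(i + 2)) - L (j - 1 + -(i + 2)))
      rw [this, show j - 1 + -(i + 2) = j + -(i + 2) - 1 by ring]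

theorem s_eq {n : ℕ} [NeZero n] {s : ZMod n → ℝ} (alt : ∀ i, s (i + 1) = -s i) (i : ZMod n) :
    s i = s 0 * (-1) ^ i.val := by
  have : ∀ k : ℕ, s (k : ZMod n) = s 0 * (-1) ^ k := by
    intro k
    induction k with
    | zero => simp
    | succ k ih => push_cast; rw [alt, ih]; ring
  have h := this i.val
  rwa [ZMod.natCast_zmod_val] at h

theorem chi_alt {n : ℕ} [NeZero n] (hn : Even n) (i : ZMod n) :
    (-1 : ℝ) ^ (i + 1).val = - (-1) ^ i.val := by
  have h : (i + 1).val = (i.val + 1) % n := by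
    conv_lhs => rw [← ZMod.natCast_zmod_val i]
    rw [← Nat.cast_one, ← Nat.cast_add, ZMod.val_natCast]
  have hp : (-1 : ℝ) ^ ((i.val + 1) % n) = (-1) ^ (i.val + 1) := by
    conv_rhs => rw [← Nat.mod_add_div (i.val + 1) n, pow_add, pow_mul, hn.neg_one_pow, one_pow, mul_one]
  rw [h, hp, pow_succ]; ring

theorem x_eq {n : ℕ} [NeZero n] {θ : ZMod n → ℝ} (heq : ∀ i j : ZMod n, θ i = θ j) (i : ZMod n) :
    foldedX n θ i = θ 0 * (1 - (-1) ^ i.val) / 2 := by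
  unfold foldedX
  generalize i.val = k
  induction k with
  | zero => simp
  | succ k ih => rw [Finset.sum_range_succ, ih, heq (k : ZMod n) 0]; ring

theorem valid_iff {n : ℕ} [NeZero n] {θ : ZMod n → ℝ} (hcc : IsClosedCycle n θ)
    (heq : ∀ i j : ZMod n, θ i = θ j) (L s : ZMod n → ℝ) (pm : ∀ i, s i = 1 ∨ s i = -1)
    (alt : ∀ i, s (i + 1) = -s i) : ValidLayering n (foldedX n θ) L ↔ Good n L s := by
  obtain ⟨hn, h2, hpos, -⟩ := hcc
  have hc := hpos 0
  have hx : ∀ i, foldedX n θ i = θ 0 * (1 - s 0 * s i) / 2 := by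
    intro i
    rw [x_eq heq, s_eq alt i]
    rcases pm 0 with h | h <;> rw [h] <;> ring
  have hxx : ∀ i j, foldedX n θ i = foldedX n θ j ↔ s i = s j := by
    intro i j
    rw [hx, hx]
    constructor
    · intro h
      have : θ 0 * (s 0 * s i) = θ 0 * (s 0 * s j) := by linarith
      have := mul_left_cancel₀ hc.ne' this
      exact mul_left_cancel₀ (by rcases pm 0 with h | h <;> rw [h] <;> norm_num) this
    · intro h; rw [h]
  have main : Function.Injective L → ∀ i j, i ≠ j → s i = s j → 
      ((Disjoint (betw (L (i - 1)) (L i)) (betw (L (j - 1)) (L j)) ∨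
        betw (L (i - 1)) (L i) ⊆ betw (L (j - 1)) (L j) ∨
        betw (L (j - 1)) (L j) ⊆ betw (L (i - 1)) (L i)) ↔ 
       (Btn (L (i - 1)) (L i) (L (j - 1)) ↔ Btn (L (i - 1)) (L i) (L j))) := by
    intro inj i j hij hs
    have ne : ∀ {i j}, i ≠ j → L i ≠ L j := fun hij e => hij (inj e)
    obtain ⟨w1, w2, w3, w4, w5⟩ := four_ne pm alt hij hs
    exact nc_iff (ne w4.symm) (ne w5.symm) (ne w3) (ne w2) (ne w1) (ne hij)
  constructor
  · rintro ⟨inj, -, h⟩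
    refine ⟨inj, pm, alt, fun i j hij hs => (main inj i j hij hs).1 (h i j hij ((hxx i j).2 hs) ?_)⟩
    rw [(hxx i j).2 hs, (hxx (i + 1) (j + 1)).2 (by rw [alt, alt, hs])]
  · intro g
    refine ⟨g.inj, ?_, fun i j hij hx _ => 
      (main g.inj i j hij ((hxx i j).1 hx)).2 (g.nc i j hij ((hxx i j).1 hx))⟩
    intro i e he
    exfalso
    have he' : s i = s e ∨ s i = s (e + 1) := by
      have := alt e
      have := pm i
      have := pm e
      grind
    rw [← hxx, ← hxx] at he'
    unfold betw at he
    rw [Set.mem_Ioo] at he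
    grind

theorem sign_pm {a b : ℝ} (h : a ≠ b) : Real.sign (a - b) = 1 ∨ Real.sign (a - b) = -1 := by
  rcases lt_or_gt_of_ne h with h | h
  · right; exact Real.sign_of_neg (by linarith)
  · left; exact Real.sign_of_pos (by linarith)

theorem count_iff {n : ℕ} [NeZero n] (μ : ZMod n → MV) :
    (Finset.univ.filter fun i : ZMod n => μ i = MV.valley).card =
        (Finset.univ.filter fun i : ZMod n => μ i = MV.mountain).card + 2 ↔
    ∑ i, (if μ i = MV.valley then (1 : ℝ) else -1) = 2 := by
  have h : ∑ i, (if μ i = MV.valley then (1 : ℝ) else -1) =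
      ((Finset.univ.filter fun i : ZMod n => μ i = MV.valley).card : ℝ) -
        ((Finset.univ.filter fun i : ZMod n => μ i = MV.mountain).card : ℝ) := by
    rw [Finset.card_filter, Finset.card_filter]
    push_cast
    rw [← Finset.sum_sub_distrib]
    apply Finset.sum_congr rfl
    intro i _
    cases μ i <;> simp
  rw [h, sub_eq_iff_eq_add]
  constructor
  · intro e; rw [e]; push_cast; ring
  · intro e; have : ((Finset.univ.filter fun i : ZMod n => μ i = MV.valley).card : ℝ) = 
      (((Finset.univ.filter fun i : ZMod n => μ i = MV.mountain).card + 2 : ℕ) : ℝ) := by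
      rw [e]; push_cast; ring
    exact_mod_cast this

/-- Case A: an MV assignment on a closed cycle with all edge lengths equal is
flat foldable as an interior face iff there are exactly 2 more valleys than
mountains. -/
theorem equal_lengths_interior (n : ℕ) [NeZero n] (θ : ZMod n → ℝ)
    (hcc : IsClosedCycle n θ) (heq : ∀ i j : ZMod n, θ i = θ j)
    (μ : ZMod n → MV) :
    FlatFoldable n θ μ Des.interior ↔
      (Finset.univ.filter fun i : ZMod n => μ i = MV.valley).card =
        (Finset.univ.filter fun i : ZMod n => μ i = MV.mountain).card + 2 := by
  rw [count_iff]
  have hn := hcc.1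
  have h2 := hcc.2.1
  obtain ⟨k, rfl⟩ : ∃ k, n = 2 * (k + 1) := by
    obtain ⟨r, hr⟩ := hn
    exact ⟨r - 1, by omega⟩
  constructor
  · rintro ⟨L, hL, t, ht, s, pm, alt, hst, hμ⟩
    have g := (valid_iff hcc heq L s pm alt).1 hL
    have := fwd k L s g t ht
    rw [hst] at this
    simp only [epsOf] at this
    norm_num at this
    rw [← this]
    apply Finset.sum_congr rfl
    intro i _
    have hne : L i ≠ L (i - 1) := by
      intro e
      have h1 := s_prev alt i
      rw [← g.inj e] at h1
      have := pm i
      grind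
    have a := pm (i - 1)
    have b := sign_pm hne
    have c := hμ i
    by_cases h : μ i = MV.valley
    · rw [if_pos h, ← c.1 h]
      rcases a with a | a <;> rw [a] <;> norm_num
    · rw [if_neg h]
      have : ¬ s (i - 1) = Real.sign (L i - L (i - 1)) := fun e => h (c.2 e)
      rcases a with a | a <;> rcases b with b | b <;> rw [a, b] at this ⊢ <;> first | (exact absurd rfl this) | norm_num
  · intro hsum
    have pm : ∀ i : ZMod (2 * (k + 1)), (-1 : ℝ) ^ i.val = 1 ∨ (-1 : ℝ) ^ i.val = -1 :=
      fun i => neg_one_pow_eq_or ℝ _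
    obtain ⟨L, t, g, ht, hst, hturn⟩ := bwd k (fun i => if μ i = MV.valley then (1 : ℝ) else -1)
      (fun i => (-1 : ℝ) ^ i.val) (fun i => by split_ifs <;> simp) pm (chi_alt hn) hsum
    refine ⟨L, (valid_iff hcc heq L _ pm (chi_alt hn)).2 g, t, ht, _, pm, chi_alt hn, hst, fun i => ?_⟩
    have h := hturn i
    have hne : L i ≠ L (i - 1) := by
      intro e
      have h1 := s_prev (s := fun i : ZMod (2 * (k + 1)) => (-1 : ℝ) ^ i.val) g.alt i
      rw [← g.inj e] at h1
      have := pm i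
      grind
    have a := pm (i - 1)
    have b := sign_pm hne
    rcases a with a | a <;> rcases b with b | b <;> rw [a, b] at h ⊢ <;>
      by_cases hv : μ i = MV.valley <;> simp [hv] at h ⊢ <;> linarith
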